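/- Let G be a locally finite connected graph and let x,y ∈ V(G) be distinct vertices. Then the function φ(α) = Ric_α(x,y)/(1 − α) is nondecreasing in α on [0,1). -/

import Mathlib

namespace ORC

variable {V : Type*}

/-- A coupling of two finitely supported probability distributions `μ` and `ν` on `V`:
a matrix `A : V × V → [0,1]` with finite support whose row sums are `μ` and column sums
are `ν`. -/
def IsCoupling (μ ν : V → ℝ) (A : V → V → ℝ) : Prop :=
  (∀ u v, 0 ≤ A u v ∧ A u v ≤ 1) ∧
  (Function.support fun p : V × V => A p.1 p.2).Finite ∧
  (∀ u, ∑ᶠ v, A u v = μ u) ∧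
  (∀ v, ∑ᶠ u, A u v = ν v)

/-- The 1-Wasserstein distance between finitely supported distributions `μ`, `ν` with
respect to the distance `d`: the infimum over couplings `A` of `Σ A(u,v) d(u,v)`. -/
noncomputable def W1 (d : V → V → ℝ) (μ ν : V → ℝ) : ℝ :=
  sInf {c | ∃ A : V → V → ℝ, IsCoupling μ ν A ∧ c = ∑ᶠ (u : V) (v : V), A u v * d u v}

/-- The graph (shortest-path) distance, as a real number. -/
noncomputable def gdist (G : SimpleGraph V) : V → V → ℝ := fun u v => (G.dist u v : ℝ)

open scoped Classical in
/-- The Lin–Lu–Yau measure `m_x^α`: mass `α` at `x`, mass `(1-α)/d_x` at each neighbor of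
`x`, and `0` elsewhere. -/
noncomputable def mAlpha (G : SimpleGraph V) [∀ v, Fintype (G.neighborSet v)]
    (α : ℝ) (x : V) : V → ℝ := fun v =>
  if v = x then α else if G.Adj x v then (1 - α) / (G.degree x : ℝ) else 0

/-- The `α`-Ricci curvature `Ric_α(x,y) = 1 - W1(m_x^α, m_y^α)/d(x,y)`. -/
noncomputable def ricAlpha (G : SimpleGraph V) [∀ v, Fintype (G.neighborSet v)]
    (α : ℝ) (x y : V) : ℝ :=
  1 - W1 (gdist G) (mAlpha G α x) (mAlpha G α y) / gdist G x y

end ORC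

open ORC

namespace ORC

variable {V : Type*}

/-- A finitely supported probability distribution. -/
structure IsFinProb (μ : V → ℝ) : Prop where
  nonneg : ∀ v, 0 ≤ μ v
  finite_support : μ.support.Finite
  finsum_eq_one : ∑ᶠ v, μ v = 1

theorem IsFinProb.le_one {μ : V → ℝ} (hμ : IsFinProb μ) (v : V) : μ v ≤ 1 :=
  hμ.finsum_eq_one ▸ single_le_finsum v hμ.finite_support hμ.nonneg

theorem isFinProb_single [DecidableEq V] (x : V) : IsFinProb (Pi.single x (1 : ℝ)) where
  nonneg v := by
    by_cases h : v = x
    · subst h; simp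
    · simp [h]
  finite_support := (Set.finite_singleton x).subset (Pi.support_single_subset)
  finsum_eq_one := by
    rw [finsum_eq_single _ x fun v hv => by simp [hv]]
    simp

/-- The product of two probability distributions is a coupling of them. -/
theorem IsFinProb.isCoupling_mul {μ ν : V → ℝ} (hμ : IsFinProb μ) (hν : IsFinProb ν) :
    IsCoupling μ ν fun u v => μ u * ν v := by
  refine ⟨fun u v => ⟨mul_nonneg (hμ.nonneg u) (hν.nonneg v),
    mul_le_one₀ (hμ.le_one u) (hν.nonneg v) (hν.le_one v)⟩, ?_, fun u => ?_, fun v => ?_⟩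
  · refine (hμ.finite_support.prod hν.finite_support).subset fun p hp => ?_
    exact ⟨left_ne_zero_of_mul hp, right_ne_zero_of_mul hp⟩
  · rw [← mul_finsum, hν.finsum_eq_one, mul_one]
  · rw [← finsum_mul, hμ.finsum_eq_one, one_mul]

theorem finsum_linear_combination {f g : V → ℝ} (hf : f.support.Finite) (hg : g.support.Finite)
    (s t : ℝ) : ∑ᶠ v, (s * f v + t * g v) = s * ∑ᶠ v, f v + t * ∑ᶠ v, g v := by
  rw [mul_finsum, mul_finsum]
  exact finsum_add_distrib (hf.subset fun v hv => right_ne_zero_of_mul hv)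
    (hg.subset fun v hv => right_ne_zero_of_mul hv)

theorem IsCoupling.finite_support_row {μ ν : V → ℝ} {A : V → V → ℝ} (hA : IsCoupling μ ν A)
    (u : V) : (fun v => A u v).support.Finite :=
  (hA.2.1.image Prod.snd).subset fun v hv => ⟨(u, v), hv, rfl⟩

theorem IsCoupling.finite_support_col {μ ν : V → ℝ} {A : V → V → ℝ} (hA : IsCoupling μ ν A)
    (v : V) : (fun u => A u v).support.Finite :=
  (hA.2.1.image Prod.fst).subset fun u hu => ⟨(u, v), hu, rfl⟩

theorem IsCoupling.finite_support_row_cost {μ ν : V → ℝ} {A : V → V → ℝ}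
    (hA : IsCoupling μ ν A) (d : V → V → ℝ) (u : V) :
    (fun v => A u v * d u v).support.Finite :=
  (hA.finite_support_row u).subset fun _ hv => left_ne_zero_of_mul hv

theorem IsCoupling.finite_support_cost {μ ν : V → ℝ} {A : V → V → ℝ}
    (hA : IsCoupling μ ν A) (d : V → V → ℝ) :
    (fun u => ∑ᶠ v, A u v * d u v).support.Finite := by
  refine (hA.2.1.image Prod.fst).subset fun u hu => ?_
  obtain ⟨v, hv⟩ : ∃ v, A u v * d u v ≠ 0 := by
    by_contra! h
    exact hu (by simp [h])
  exact ⟨(u, v), left_ne_zero_of_mul hv, rfl⟩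

theorem IsCoupling.convex_combination {μ ν μ' ν' : V → ℝ} {A B : V → V → ℝ}
    (hA : IsCoupling μ ν A) (hB : IsCoupling μ' ν' B) {s t : ℝ} (hs : 0 ≤ s) (ht : 0 ≤ t)
    (hst : s + t = 1) :
    IsCoupling (fun u => s * μ u + t * μ' u) (fun v => s * ν v + t * ν' v)
      fun u v => s * A u v + t * B u v := by
  refine ⟨fun u v => ⟨?_, ?_⟩, ?_, fun u => ?_, fun v => ?_⟩
  · exact add_nonneg (mul_nonneg hs (hA.1 u v).1) (mul_nonneg ht (hB.1 u v).1)
  · nlinarith [(hA.1 u v).2, (hB.1 u v).2]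
  · refine (hA.2.1.union hB.2.1).subset fun p hp => ?_
    by_contra! h
    simp only [Set.mem_union, Function.mem_support, not_or, not_not] at h
    exact hp (by simp [h.1, h.2])
  · rw [finsum_linear_combination (hA.finite_support_row u) (hB.finite_support_row u),
      hA.2.2.1, hB.2.2.1]
  · rw [finsum_linear_combination (hA.finite_support_col v) (hB.finite_support_col v),
      hA.2.2.2, hB.2.2.2]

theorem IsCoupling.cost_linear_combination {μ ν μ' ν' : V → ℝ} {A B : V → V → ℝ}
    (hA : IsCoupling μ ν A) (hB : IsCoupling μ' ν' B) (d : V → V → ℝ) (s t : ℝ) :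
    ∑ᶠ (u : V) (v : V), (s * A u v + t * B u v) * d u v =
      s * ∑ᶠ (u : V) (v : V), A u v * d u v + t * ∑ᶠ (u : V) (v : V), B u v * d u v := by
  rw [← finsum_linear_combination (hA.finite_support_cost d) (hB.finite_support_cost d)]
  refine finsum_congr fun u => ?_
  rw [← finsum_linear_combination (hA.finite_support_row_cost d u)
    (hB.finite_support_row_cost d u)]
  exact finsum_congr fun v => by ring

theorem W1_le_cost {d : V → V → ℝ} (hd : ∀ u v, 0 ≤ d u v) {μ ν : V → ℝ} {A : V → V → ℝ}
    (hA : IsCoupling μ ν A) : W1 d μ ν ≤ ∑ᶠ (u : V) (v : V), A u v * d u v := by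
  refine csInf_le ⟨0, ?_⟩ ⟨A, hA, rfl⟩
  rintro _ ⟨B, hB, rfl⟩
  exact finsum_nonneg fun u => finsum_nonneg fun v => mul_nonneg (hB.1 u v).1 (hd u v)

/-- Moving both marginals towards Dirac masses at `x` and `y` changes the Wasserstein distance at
most as much as the convex combination with `d x y`. -/
theorem W1_convex_combination_single_le [DecidableEq V] {d : V → V → ℝ}
    (hd : ∀ u v, 0 ≤ d u v) {μ ν : V → ℝ} (hμ : IsFinProb μ) (hν : IsFinProb ν) (x y : V)
    {s t : ℝ} (hs : 0 ≤ s) (ht : 0 ≤ t) (hst : s + t = 1) :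
    W1 d (fun u => s * μ u + t * Pi.single (M := fun _ => ℝ) x 1 u)
      (fun v => s * ν v + t * Pi.single (M := fun _ => ℝ) y 1 v) ≤ s * W1 d μ ν + t * d x y := by
  have hB := (isFinProb_single x).isCoupling_mul (isFinProb_single y)
  have hcost : ∑ᶠ (u : V) (v : V),
      Pi.single (M := fun _ => ℝ) x 1 u * Pi.single (M := fun _ => ℝ) y 1 v * d u v = d x y := by
    rw [finsum_eq_single _ x fun u hu => by simp [hu],
      finsum_eq_single _ y fun v hv => by simp [hv]]
    simp
  rcases hs.eq_or_lt with rfl | hs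
  · have h := W1_le_cost hd
      ((hμ.isCoupling_mul hν).convex_combination hB le_rfl ht hst)
    rw [(hμ.isCoupling_mul hν).cost_linear_combination hB, hcost] at h
    simpa using h
  · rw [← sub_le_iff_le_add, ← div_le_iff₀' hs]
    refine le_csInf ⟨_, _, hμ.isCoupling_mul hν, rfl⟩ ?_
    rintro _ ⟨A, hA, rfl⟩
    rw [div_le_iff₀' hs, sub_le_iff_le_add, ← hcost, ← hA.cost_linear_combination hB]
    exact W1_le_cost hd (hA.convex_combination hB hs.le ht hst)

variable (G : SimpleGraph V) [∀ v, Fintype (G.neighborSet v)]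

theorem isFinProb_mAlpha {α : ℝ} (hα : 0 ≤ α) (hα' : α ≤ 1) {x : V} (hx : 0 < G.degree x) :
    IsFinProb (mAlpha G α x) := by
  classical
  have hsupp : (mAlpha G α x).support ⊆ (insert x (G.neighborFinset x) : Finset V) := by
    intro v hv
    by_contra h
    simp only [Finset.coe_insert, Set.mem_insert_iff, Finset.mem_coe,
      SimpleGraph.mem_neighborFinset, not_or] at h
    exact hv (by simp [mAlpha, h.1, h.2])
  refine ⟨fun v => ?_, (Finset.finite_toSet _).subset hsupp, ?_⟩
  · unfold mAlpha
    have := sub_nonneg.2 hα'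
    split_ifs <;> positivity
  · rw [finsum_eq_sum_of_support_subset _ hsupp, Finset.sum_insert (by simp)]
    have hsum : ∑ v ∈ G.neighborFinset x, mAlpha G α x v =
        ∑ v ∈ G.neighborFinset x, (1 - α) / (G.degree x : ℝ) := by
      refine Finset.sum_congr rfl fun v hv => ?_
      rw [SimpleGraph.mem_neighborFinset] at hv
      simp [mAlpha, hv, hv.ne']
    have hne : (G.degree x : ℝ) ≠ 0 := by exact_mod_cast hx.ne'
    rw [hsum, Finset.sum_const, SimpleGraph.card_neighborFinset_eq_degree, nsmul_eq_mul,
      mul_div_cancel₀ _ hne]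
    simp [mAlpha]

theorem mAlpha_eq_convex_combination [DecidableEq V] {α : ℝ} (hα : α < 1) (β : ℝ) (x : V) :
    mAlpha G β x = fun v => (1 - β) / (1 - α) * mAlpha G α x v +
      (β - α) / (1 - α) * Pi.single (M := fun _ => ℝ) x 1 v := by
  have hα' : 1 - α ≠ 0 := (sub_pos.2 hα).ne'
  funext v
  by_cases hv : v = x
  · subst hv
    simp only [mAlpha, if_true, Pi.single_eq_same]
    field_simp
    ring
  · simp only [mAlpha, hv, if_false, Pi.single_eq_of_ne, ne_eq, not_false_eq_true]
    split_ifs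
    · field_simp
      ring
    · ring

end ORC

/-- For distinct vertices `x, y` of a locally finite connected graph, the function
`φ(α) = Ric_α(x,y)/(1-α)` is nondecreasing on `[0,1)`. -/
theorem ricAlpha_div_monotone {V : Type*} (G : SimpleGraph V)
    [∀ v, Fintype (G.neighborSet v)] (hconn : G.Connected) (x y : V) (hxy : x ≠ y)
    (α β : ℝ) (hα : 0 ≤ α) (hαβ : α ≤ β) (hβ : β < 1) :
    ricAlpha G α x y / (1 - α) ≤ ricAlpha G β x y / (1 - β) := by
  classical
  have : Nontrivial V := ⟨x, y, hxy⟩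
  have hα1 : 0 < 1 - α := by linarith
  have hβ1 : 0 < 1 - β := by linarith
  have hd : 0 < gdist G x y := Nat.cast_pos.2 (hconn.pos_dist_of_ne hxy)
  have hprob (v : V) : IsFinProb (mAlpha G α v) :=
    isFinProb_mAlpha G hα (by linarith) (hconn.preconnected.degree_pos_of_nontrivial v)
  have key := W1_convex_combination_single_le (d := gdist G) (fun u v => Nat.cast_nonneg _)
    (hprob x) (hprob y) x y (s := (1 - β) / (1 - α)) (t := (β - α) / (1 - α))
    (by positivity) (div_nonneg (by linarith) hα1.le) (by field_simp; ring)
  rw [← mAlpha_eq_convex_combination G (by linarith), ← mAlpha_eq_convex_combination G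
    (by linarith), div_mul_eq_mul_div, div_mul_eq_mul_div, ← add_div, le_div_iff₀ hα1] at key
  rw [ricAlpha, ricAlpha, div_le_div_iff₀ hα1 hβ1, one_sub_div hd.ne', one_sub_div hd.ne',
    div_mul_eq_mul_div, div_mul_eq_mul_div]
  refine div_le_div_of_nonneg_right ?_ hd.le
  linarith
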